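/- arXiv:2605.11552 — 5 statements merged into one kernel-verified Lean document; each statement's English description precedes it below -/
import Mathlib

section
/- Let G and Q be groups with finitely generated abelianizations, let n be a natural number, and let l : ℤ^n → G and f : G → Q be group homomorphisms such that f is surjective, the image of l equals the kernel of f, and rank(G^{ab}) − rank(Q^{ab}) = n. Then l is injective and the image of l intersects the commutator subgroup [G,G] trivially, i.e. l(ℤ^n) ∩ [G,G] = {1}. -/
open TensorProduct

/-- The rank of the abelianization of a group `G`, i.e. `dim_ℚ (ℚ ⊗_ℤ G^{ab})`. -/
noncomputable def abRank (G : Type*) [Group G] : ℕ :=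
  Module.finrank ℚ (ℚ ⊗[ℤ] Additive (Abelianization G))

/-- Abelianization is right exact: an element of `Gᵃᵇ` that dies in `Qᵃᵇ` comes from the kernel
of the surjection `f : G → Q`. -/
theorem Abelianization.exists_mem_ker_of_map_eq_one {G Q : Type*} [Group G] [Group Q]
    {f : G →* Q} (hf : Function.Surjective f) {a : Abelianization G}
    (ha : Abelianization.map f a = 1) : ∃ k ∈ f.ker, Abelianization.of k = a := by
  obtain ⟨g, rfl⟩ := QuotientGroup.mk_surjective a
  change Abelianization.of (f g) = 1 at ha
  rw [← MonoidHom.mem_ker, Abelianization.ker_of, commutator_def,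
    ← MonoidHom.range_eq_top.mpr hf, MonoidHom.range_eq_map, ← Subgroup.map_commutator] at ha
  obtain ⟨c, hc, hcg⟩ := ha
  have hc' : Abelianization.of c = 1 := by
    rwa [← MonoidHom.mem_ker, Abelianization.ker_of]
  refine ⟨g * c⁻¹, by simp [MonoidHom.mem_ker, hcg], ?_⟩
  rw [map_mul, map_inv, hc', inv_one, mul_one]
  rfl

/-- In a right exact sequence `ℤⁿ → A → B → 0` with `rank A = rank B + n`, the first map is
injective. -/
theorem injective_of_exact_of_finrank_eq_add {n : ℕ} {A B : Type*} [AddCommGroup A]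
    [AddCommGroup B] [Module.Finite ℤ A] (α : (Fin n → ℤ) →ₗ[ℤ] A) (φ : A →ₗ[ℤ] B)
    (hφ : Function.Surjective φ) (hex : Function.Exact α φ)
    (hrank : Module.finrank ℚ (ℚ ⊗[ℤ] A) = Module.finrank ℚ (ℚ ⊗[ℤ] B) + n) :
    Function.Injective α := by
  let e := TensorProduct.piScalarRight ℤ ℚ ℚ (Fin n)
  have : Module.Finite ℚ (ℚ ⊗[ℤ] (Fin n → ℤ)) := Module.Finite.equiv e.symm
  have hn : Module.finrank ℚ (ℚ ⊗[ℤ] (Fin n → ℤ)) = n := by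
    rw [e.finrank_eq, Module.finrank_fin_fun]
  have hexT : Function.Exact (α.baseChange ℚ) (φ.baseChange ℚ) := lTensor_exact ℚ hex hφ
  have hsurj : Function.Surjective (φ.baseChange ℚ) := LinearMap.lTensor_surjective ℚ hφ
  have h1 := (φ.baseChange ℚ).finrank_range_add_finrank_ker
  have h2 := (α.baseChange ℚ).finrank_range_add_finrank_ker
  rw [LinearMap.range_eq_top.mpr hsurj, finrank_top, hexT.linearMap_ker_eq] at h1
  have hker : LinearMap.ker (α.baseChange ℚ) = ⊥ := Submodule.finrank_eq_zero.mp (by omega)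
  rw [injective_iff_map_eq_zero]
  intro x hx
  have hx' : (1 : ℚ) ⊗ₜ[ℤ] x = 0 :=
    LinearMap.ker_eq_bot.mp hker (by simp [hx])
  funext i
  simpa [e] using congrFun (congrArg e hx') i

theorem torus_bundle_pi1_injective_and_trivial_commutator_intersection
    {G Q : Type*} [Group G] [Group Q] (n : ℕ)
    [Group.FG (Abelianization G)] [Group.FG (Abelianization Q)]
    (l : Multiplicative (Fin n → ℤ) →* G) (f : G →* Q)
    (hf : Function.Surjective f) (hlf : l.range = f.ker)
    (hrank : (abRank G : ℤ) - (abRank Q : ℤ) = n) :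
    Function.Injective l ∧ l.range ⊓ commutator G = ⊥ := by
  have : Module.Finite ℤ (Additive (Abelianization G)) :=
    Module.Finite.iff_addGroup_fg.mpr inferInstance
  let α : (Fin n → ℤ) →ₗ[ℤ] Additive (Abelianization G) :=
    (MonoidHom.toAdditiveRight (Abelianization.of.comp l)).toIntLinearMap
  let φ : Additive (Abelianization G) →ₗ[ℤ] Additive (Abelianization Q) :=
    (MonoidHom.toAdditive (Abelianization.map f)).toIntLinearMap
  have hφ : Function.Surjective φ := by
    intro b
    obtain ⟨q, hq⟩ := QuotientGroup.mk_surjective b.toMul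
    obtain ⟨g, rfl⟩ := hf q
    exact ⟨Additive.ofMul (Abelianization.of g), hq⟩
  have hex : Function.Exact α φ := by
    intro a
    constructor
    · intro ha
      obtain ⟨k, hk, hka⟩ := Abelianization.exists_mem_ker_of_map_eq_one (a := a.toMul) hf ha
      rw [← hlf] at hk
      obtain ⟨x, rfl⟩ := hk
      exact ⟨x.toAdd, hka⟩
    · rintro ⟨x, rfl⟩
      have hx : f (l (Multiplicative.ofAdd x)) = 1 := by
        rw [← MonoidHom.mem_ker, ← hlf]
        exact ⟨_, rfl⟩
      change Abelianization.of (f (l (Multiplicative.ofAdd x))) = 1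
      rw [hx, map_one]
  have hα : Function.Injective α :=
    injective_of_exact_of_finrank_eq_add α φ hφ hex (by unfold abRank at hrank; omega)
  have hl : Function.Injective (Abelianization.of.comp l) := hα
  refine ⟨Function.Injective.of_comp hl, ?_⟩
  rw [eq_bot_iff]
  rintro _ ⟨⟨x, rfl⟩, hx⟩
  rw [← Abelianization.ker_of] at hx
  have hx1 : x = 1 := hl ((MonoidHom.mem_ker.mp hx).trans (map_one _).symm)
  simp [hx1]
end

section
/- Let G and Q be groups with finitely generated abelianizations, let n be a natural number, and let l : ℤ^n → G and f : G → Q be group homomorphisms such that f is surjective, the image of l equals the kernel of f, and rank(G^{ab}) − rank(Q^{ab}) = n. Let h_G : G → G^{ab} be the canonical projection, l̄ := h_G ∘ l : ℤ^n → G^{ab}, and f^{ab} : G^{ab} → Q^{ab} the induced map. Then the sequence 0 → ℤ^n → G^{ab} → Q^{ab} → 0 is exact: l̄ is injective, the image of l̄ equals the kernel of f^{ab}, and f^{ab} is surjective. -/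
open TensorProduct

lemma LinearMap.finrank_eq_finrank_range_add_finrank_ker {R M N : Type*} [CommRing R] [IsDomain R]
    [AddCommGroup M] [Module R M] [Module.Finite R M] [AddCommGroup N] [Module R N]
    (φ : M →ₗ[R] N) :
    Module.finrank R M = Module.finrank R φ.range + Module.finrank R φ.ker := by
  rw [← φ.quotKerEquivRange.finrank_eq, Submodule.finrank_quotient_add_finrank]

lemma LinearMap.injective_of_finrank_eq_add_of_range_eq_ker {R M N P : Type*} [CommRing R]
    [IsDomain R] [IsNoetherianRing R] [AddCommGroup M] [Module R M] [Module.Finite R M]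
    [Module.IsTorsionFree R M]
    [AddCommGroup N] [Module R N] [Module.Finite R N] [AddCommGroup P] [Module R P]
    {ψ : M →ₗ[R] N} {φ : N →ₗ[R] P} (hψφ : ψ.range = φ.ker) (hφ : Function.Surjective φ)
    (hrank : Module.finrank R N = Module.finrank R P + Module.finrank R M) :
    Function.Injective ψ := by
  have h₁ := ψ.finrank_eq_finrank_range_add_finrank_ker
  have h₂ := φ.finrank_eq_finrank_range_add_finrank_ker
  rw [LinearMap.range_eq_top.mpr hφ, finrank_top, ← hψφ] at h₂
  rw [← LinearMap.ker_eq_bot, ← Submodule.finrank_eq_zero (R := R)]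
  lia

lemma abRank_eq_finrank_int (G : Type*) [Group G] :
    abRank G = Module.finrank ℤ (Additive (Abelianization G)) :=
  (TensorProduct.isBaseChange ℤ (Additive (Abelianization G)) ℚ).finrank_eq

lemma Abelianization.map_surjective {G H : Type*} [Group G] [Group H] {f : G →* H}
    (hf : Function.Surjective f) : Function.Surjective (Abelianization.map f) := by
  intro y
  obtain ⟨h, rfl⟩ := QuotientGroup.mk_surjective y
  obtain ⟨g, rfl⟩ := hf h
  exact ⟨Abelianization.of g, Abelianization.map_of f g⟩

lemma Abelianization.ker_map_of_surjective {G H : Type*} [Group G] [Group H] {f : G →* H}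
    (hf : Function.Surjective f) :
    (Abelianization.map f).ker = f.ker.map Abelianization.of := by
  ext x
  obtain ⟨g, rfl⟩ : ∃ g, Abelianization.of g = x := QuotientGroup.mk_surjective x
  constructor
  · intro hx
    rw [MonoidHom.mem_ker, Abelianization.map_of, ← MonoidHom.mem_ker, Abelianization.ker_of,
      commutator_def, ← Subgroup.map_top_of_surjective f hf, ← Subgroup.map_commutator] at hx
    obtain ⟨c, hc, hcg⟩ := hx
    have hc' : Abelianization.of c = 1 := by
      rwa [← MonoidHom.mem_ker, Abelianization.ker_of]
    exact ⟨g * c⁻¹, by simp [MonoidHom.mem_ker, hcg], by simp [hc']⟩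
  · rintro ⟨k, hk, hkg⟩
    rw [← hkg, MonoidHom.mem_ker, Abelianization.map_of, MonoidHom.mem_ker.mp hk, map_one]

theorem abelianized_sequence_exact
    {G Q : Type*} [Group G] [Group Q] (n : ℕ)
    [Group.FG (Abelianization G)] [Group.FG (Abelianization Q)]
    (l : Multiplicative (Fin n → ℤ) →* G) (f : G →* Q)
    (hf : Function.Surjective f) (hlf : l.range = f.ker)
    (hrank : (abRank G : ℤ) - (abRank Q : ℤ) = n) :
    Function.Injective ((Abelianization.of).comp l) ∧
      ((Abelianization.of).comp l).range = (Abelianization.map f).ker ∧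
      Function.Surjective (Abelianization.map f) := by
  have hsurj := Abelianization.map_surjective hf
  have hexact : ((Abelianization.of).comp l).range = (Abelianization.map f).ker := by
    rw [Abelianization.ker_map_of_surjective hf, MonoidHom.range_comp, hlf]
  refine ⟨?_, hexact, hsurj⟩
  have : Module.Finite ℤ (Additive (Abelianization G)) :=
    Module.Finite.iff_addGroup_fg.mpr inferInstance
  let ψ : (Fin n → ℤ) →ₗ[ℤ] Additive (Abelianization G) :=
    (MonoidHom.toAdditiveRight ((Abelianization.of).comp l)).toIntLinearMap
  let φ : Additive (Abelianization G) →ₗ[ℤ] Additive (Abelianization Q) :=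
    (MonoidHom.toAdditive (Abelianization.map f)).toIntLinearMap
  have hψφ : ψ.range = φ.ker := by
    ext x
    exact SetLike.ext_iff.mp hexact x.toMul
  have hψ : Function.Injective ψ := by
    refine LinearMap.injective_of_finrank_eq_add_of_range_eq_ker hψφ hsurj ?_
    rw [← abRank_eq_finrank_int, ← abRank_eq_finrank_int, Module.finrank_fin_fun]
    lia
  exact hψ
end

section
/- Let G be a group, A a central subgroup of G with A ∩ [G,G] = {1}, h : G → G^{ab} the canonical projection, and S a subgroup of G^{ab} with h(A) ∩ S = {0}. Then A ∩ h⁻¹(S) = {1} and the subgroup A·h⁻¹(S) generated by A and h⁻¹(S) is their internal direct product. Moreover, if G^{ab} is the internal direct sum of h(A) and S, then G = A·h⁻¹(S), so G is the internal direct product of A and h⁻¹(S). -/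
open Pointwise

theorem central_subgroup_direct_product_with_preimage
    {G : Type*} [Group G] (A : Subgroup G)
    (hAcentral : A ≤ Subgroup.center G)
    (hAcomm : A ⊓ commutator G = ⊥)
    (S : Subgroup (Abelianization G))
    (hAS : A.map (Abelianization.of : G →* Abelianization G) ⊓ S = ⊥) :
    A ⊓ S.comap (Abelianization.of : G →* Abelianization G) = ⊥ ∧
    (∀ a ∈ A, ∀ b ∈ S.comap (Abelianization.of : G →* Abelianization G), a * b = b * a) ∧
    (A : Set G) * (S.comap (Abelianization.of : G →* Abelianization G) : Set G) =
      ((A ⊔ S.comap (Abelianization.of : G →* Abelianization G) : Subgroup G) : Set G) ∧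
    (A.map (Abelianization.of : G →* Abelianization G) ⊔ S = ⊤ →
      (A : Set G) * (S.comap (Abelianization.of : G →* Abelianization G) : Set G) =
        Set.univ) := by
  refine ⟨?_, ?_, (Subgroup.mul_normal _ _).symm, ?_⟩
  · rw [Subgroup.eq_bot_iff_forall]
    rintro a ⟨haA, haS⟩
    have h_of : Abelianization.of a = 1 := by
      rw [← Subgroup.mem_bot, ← hAS]
      exact ⟨Subgroup.mem_map_of_mem _ haA, haS⟩
    rw [← Subgroup.mem_bot, ← hAcomm]
    rw [← MonoidHom.mem_ker, Abelianization.ker_of] at h_of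
    exact ⟨haA, h_of⟩
  · intro a ha b _
    exact (Subgroup.mem_center_iff.mp (hAcentral ha) b).symm
  · intro h_top
    refine Set.eq_univ_of_forall fun g => ?_
    have hg : Abelianization.of g ∈ A.map Abelianization.of ⊔ S := h_top ▸ Subgroup.mem_top _
    obtain ⟨_, ⟨a, ha, rfl⟩, s, hs, h_eq⟩ := Subgroup.mem_sup.mp hg
    refine Set.mem_mul.mpr ⟨a, ha, a⁻¹ * g, ?_, mul_inv_cancel_left a g⟩
    rw [SetLike.mem_coe, Subgroup.mem_comap, map_mul, map_inv, ← h_eq, inv_mul_cancel_left]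
    exact hs
end

section
/- Let F and G be groups and n a natural number. Suppose π : F → ℤ is a surjective homomorphism, l' : ℤ^n → F is an injective homomorphism whose image equals the kernel of π, l : ℤ^n → G is an injective homomorphism whose image satisfies l(ℤ^n) ∩ [G,G] = {1}, and φ : F → G is a homomorphism with φ ∘ l' = l. Then F is abelian. -/
open scoped commutatorElement in
theorem pullback_bundle_fundamental_group_abelian
    {F G : Type*} [Group F] [Group G] (n : ℕ)
    (π : F →* Multiplicative ℤ) (hπ : Function.Surjective π)
    (l' : Multiplicative (Fin n → ℤ) →* F) (hl'inj : Function.Injective l')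
    (hl'range : l'.range = π.ker)
    (l : Multiplicative (Fin n → ℤ) →* G) (hlinj : Function.Injective l)
    (hlcomm : l.range ⊓ commutator G = ⊥)
    (φ : F →* G) (hφ : φ.comp l' = l) :
    ∀ x y : F, x * y = y * x := by
  intro x y
  have hker : ⁅x, y⁆ ∈ π.ker := by
    rw [MonoidHom.mem_ker, map_commutatorElement, commutatorElement_eq_one_iff_mul_comm, mul_comm]
  obtain ⟨a, ha⟩ : ⁅x, y⁆ ∈ l'.range := hl'range ▸ hker
  have hla : l a = ⁅φ x, φ y⁆ := by
    rw [← hφ, MonoidHom.comp_apply, ha, map_commutatorElement]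
  have hmem : l a ∈ l.range ⊓ commutator G :=
    ⟨⟨a, rfl⟩, hla ▸ Subgroup.commutator_mem_commutator (Subgroup.mem_top _) (Subgroup.mem_top _)⟩
  rw [hlcomm, Subgroup.mem_bot, map_eq_one_iff l hlinj] at hmem
  rw [← commutatorElement_eq_one_iff_mul_comm, ← ha, hmem, map_one]
end

section
/- Let X be a nonempty connected topological space, n ≥ 1 a natural number, and Γ a finite abelian group acting on X by homeomorphisms. For each α ∈ Γ let T_α : X → ℝ^n be a continuous map, and suppose the cocycle condition modulo ℤ^n holds: for all α, β ∈ Γ and all x ∈ X, T_{α·β}(x) − T_α(β·x) − T_β(x) ∈ ℤ^n. Then the commutativity condition holds exactly (not just modulo ℤ^n): for all α, β ∈ Γ and all x ∈ X, T_α(β·x) − T_α(x) = T_β(α·x) − T_β(x). -/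
/-- A continuous real-valued function on a preconnected space with integer values is constant. -/
theorem Continuous.eq_of_forall_exists_int {X : Type*} [TopologicalSpace X] [PreconnectedSpace X]
    {f : X → ℝ} (hf : Continuous f) (hint : ∀ x, ∃ m : ℤ, f x = m) (x y : X) : f x = f y := by
  choose m hm using hint
  have hm_cont : Continuous m := by
    rw [Int.isClosedEmbedding_coe_real.isInducing.continuous_iff]
    exact hf.congr hm
  rw [hm, hm, PreconnectedSpace.constant inferInstance hm_cont]

/-- Over a finite group orbit, the increments of a function under a fixed element sum to zero. -/
theorem sum_apply_smul_smul_sub_eq_zero {X Γ A : Type*} [CommGroup Γ] [Fintype Γ] [MulAction Γ X]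
    [AddCommGroup A] (f : X → A) (β : Γ) (x : X) :
    ∑ γ : Γ, (f (β • γ • x) - f (γ • x)) = 0 := by
  rw [Finset.sum_sub_distrib, sub_eq_zero]
  simp only [smul_smul]
  exact Equiv.sum_comp (Equiv.mulLeft β) fun γ => f (γ • x)

theorem cocycle_mod_lattice_implies_exact_commutativity
    {X : Type*} [TopologicalSpace X] [ConnectedSpace X]
    (n : ℕ) (hn : 1 ≤ n)
    {Γ : Type*} [CommGroup Γ] [Finite Γ] [MulAction Γ X]
    (hcont : ∀ γ : Γ, Continuous fun x : X => γ • x)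
    (T : Γ → X → Fin n → ℝ) (hT : ∀ γ, Continuous (T γ))
    (hcocycle : ∀ α β : Γ, ∀ x : X, ∃ m : Fin n → ℤ,
      T (α * β) x - T α (β • x) - T β x = fun i => (m i : ℝ)) :
    ∀ α β : Γ, ∀ x : X, T α (β • x) - T α x = T β (α • x) - T β x := by
  intro α β x
  have := Fintype.ofFinite Γ
  ext i
  let D : X → ℝ := fun y => (T α (β • y) i - T α y i) - (T β (α • y) i - T β y i)
  have hD_cont : Continuous D := by
    have hTi (γ : Γ) : Continuous fun y => T γ y i := (continuous_apply i).comp (hT γ)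
    exact (((hTi α).comp (hcont β)).sub (hTi α)).sub (((hTi β).comp (hcont α)).sub (hTi β))
  have hD_int (y : X) : ∃ m : ℤ, D y = m := by
    obtain ⟨p, hp⟩ := hcocycle α β y
    obtain ⟨q, hq⟩ := hcocycle β α y
    have hpi := congrFun hp i
    have hqi := congrFun hq i
    rw [mul_comm β α] at hqi
    simp only [Pi.sub_apply] at hpi hqi
    refine ⟨q i - p i, ?_⟩
    push_cast
    simp only [D]
    linarith
  have hD_sum : ∑ γ : Γ, D (γ • x) = 0 := by
    simp only [D]
    rw [Finset.sum_sub_distrib, sum_apply_smul_smul_sub_eq_zero (fun y => T α y i),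
      sum_apply_smul_smul_sub_eq_zero (fun y => T β y i), sub_zero]
  have hD_zero : D x = 0 := by
    simpa [fun γ : Γ => hD_cont.eq_of_forall_exists_int hD_int (γ • x) x] using hD_sum
  exact sub_eq_zero.mp hD_zero
end
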